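/- There exist points p, q_1, …, q_14 ∈ ℂ² such that the only polynomial f ∈ ℂ[x,y] of total degree at most 27 that vanishes to order at least 5 at p and to order at least 7 at each q_i is the zero polynomial. (The linear system L_27(5, 7^14) is empty; note the number of imposed conditions C(6,2) + 14·C(8,2) = 407 exceeds C(29,2) = 406.) -/

import Mathlib

open MvPolynomial

/-- The ideal of polynomials in `ℂ[x,y]` vanishing at the point `p ∈ ℂ²`;
`f` vanishes to order at least `m` at `p` iff `f ∈ (ptIdeal p) ^ m`. -/
noncomputable def ptIdeal (p : ℂ × ℂ) : Ideal (MvPolynomial (Fin 2) ℂ) :=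
  Ideal.span {X 0 - C p.1, X 1 - C p.2}

/-! ### Vanishing order and Euler operators -/

lemma Derivation.apply_mem_ideal_pow {R A : Type*} [CommRing R] [CommRing A] [Algebra R A]
    (D : Derivation R A A) (I : Ideal A) (n : ℕ) {f : A} (hf : f ∈ I ^ (n + 1)) :
    D f ∈ I ^ n := by
  induction n generalizing f with
  | zero => simp
  | succ n ih =>
    rw [pow_succ] at hf
    induction hf using Submodule.mul_induction_on' with
    | mem_mul_mem a ha b hb =>
      rw [D.leibniz, smul_eq_mul, smul_eq_mul]
      refine add_mem (Ideal.mul_mem_right _ _ ha) ?_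
      rw [pow_succ']
      exact Ideal.mul_mem_mul hb (ih ha)
    | add a _ b _ ha hb => rw [map_add]; exact add_mem ha hb

lemma Derivation.iterate_mem_ideal_pow {R A : Type*} [CommRing R] [CommRing A] [Algebra R A]
    (D : Derivation R A A) (I : Ideal A) (n k : ℕ) {f : A} (hf : f ∈ I ^ (n + k)) :
    D^[k] f ∈ I ^ n := by
  induction k generalizing f with
  | zero => simpa using hf
  | succ k ih =>
    rw [Function.iterate_succ_apply]
    exact ih (D.apply_mem_ideal_pow I (n + k) hf)

/-- The Euler operator `xᵢ ∂/∂xᵢ`, for which every monomial is an eigenvector. -/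
noncomputable def eulerOp (i : Fin 2) :
    Derivation ℂ (MvPolynomial (Fin 2) ℂ) (MvPolynomial (Fin 2) ℂ) :=
  (X i : MvPolynomial (Fin 2) ℂ) • pderiv i

lemma coeff_eulerOp (i : Fin 2) (f : MvPolynomial (Fin 2) ℂ) (m : Fin 2 →₀ ℕ) :
    coeff m (eulerOp i f) = m i * coeff m f := by
  induction f using MvPolynomial.induction_on' with
  | monomial u a =>
    rw [eulerOp, Derivation.smul_apply, smul_eq_mul, X_mul_pderiv_monomial, coeff_smul,
      coeff_monomial]
    split_ifs with h
    · simp [h]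
    · simp
  | add p q hp hq => rw [map_add, coeff_add, coeff_add, hp, hq, mul_add]

lemma coeff_eulerOp_iterate (i : Fin 2) (k : ℕ) (f : MvPolynomial (Fin 2) ℂ)
    (m : Fin 2 →₀ ℕ) : coeff m ((eulerOp i)^[k] f) = (m i : ℂ) ^ k * coeff m f := by
  induction k with
  | zero => simp
  | succ k ih => rw [Function.iterate_succ_apply', coeff_eulerOp, ih]; ring

lemma eval_eq_zero_of_mem_ptIdeal {q : ℂ × ℂ} {f : MvPolynomial (Fin 2) ℂ}
    (hf : f ∈ ptIdeal q) : eval ![q.1, q.2] f = 0 := by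
  have h : ptIdeal q ≤ RingHom.ker (eval ![q.1, q.2]) := by
    rw [ptIdeal, Ideal.span_le]
    rintro g (rfl | rfl) <;> simp [RingHom.mem_ker]
  exact h hf

lemma sum_coeff_eq_zero_of_mem_ptIdeal_pow {q : ℂ × ℂ} {f : MvPolynomial (Fin 2) ℂ} {n : ℕ}
    (hf : f ∈ ptIdeal q ^ n) {a b : ℕ} (hab : a + b < n) :
    ∑ m ∈ f.support,
      coeff m f * ((m 0 : ℂ) ^ a * (m 1 : ℂ) ^ b) * (q.1 ^ m 0 * q.2 ^ m 1) = 0 := by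
  have hmem : (eulerOp 0)^[a] ((eulerOp 1)^[b] f) ∈ ptIdeal q := by
    rw [← pow_one (ptIdeal q)]
    refine (eulerOp 0).iterate_mem_ideal_pow _ 1 a
      ((eulerOp 1).iterate_mem_ideal_pow _ (1 + a) b (Ideal.pow_le_pow_right ?_ hf))
    omega
  have h := eval_eq_zero_of_mem_ptIdeal hmem
  rw [eval_eq'] at h
  rw [← h]
  symm
  refine (Finset.sum_subset (fun m hm => ?_) fun m _ hm => ?_).trans
    (Finset.sum_congr rfl fun m _ => ?_)
  · rw [mem_support_iff, coeff_eulerOp_iterate, coeff_eulerOp_iterate] at hm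
    exact mem_support_iff.2 fun h0 => hm (by simp [h0])
  · rw [notMem_support_iff.1 hm, zero_mul]
  · rw [coeff_eulerOp_iterate, coeff_eulerOp_iterate]
    simp only [Fin.prod_univ_two, Matrix.cons_val_zero, Matrix.cons_val_one]
    ring

lemma le_of_mem_ptIdeal_zero_pow {f : MvPolynomial (Fin 2) ℂ} {n : ℕ}
    (hf : f ∈ ptIdeal (0, 0) ^ n) {m : Fin 2 →₀ ℕ} (hm : m ∈ f.support) : n ≤ m 0 + m 1 := by
  have h : ptIdeal (0, 0) = idealOfVars (Fin 2) ℂ := by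
    rw [ptIdeal, idealOfVars]
    congr 1
    ext g
    simp [Fin.exists_fin_two, eq_comm]
  rw [h, mem_pow_idealOfVars_iff] at hf
  simpa [Finsupp.degree_eq_sum, Fin.sum_univ_two] using hf m hm

/-! ### Separating residue classes by roots of unity -/

lemma IsPrimitiveRoot.sum_filter_mod_eq_zero {ι : Type*} {N : ℕ} {ζ : ℂ}
    (hζ : IsPrimitiveRoot ζ N) (S : Finset ι) (w : ι → ℂ) (d : ι → ℕ)
    (h : ∀ k : Fin N, ∑ m ∈ S, w m * ζ ^ ((k : ℕ) * d m) = 0) {c : ℕ} (hc : c < N) :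
    ∑ m ∈ S with d m % N = c, w m = 0 := by
  have hN : (N : ℂ) ≠ 0 := by exact_mod_cast (by omega : N ≠ 0)
  have orth (m : ι) : ∑ k : Fin N, ζ ^ ((k : ℕ) * (d m + (N - c)))
      = if d m % N = c then (N : ℂ) else 0 := by
    have hdvd : N ∣ d m + (N - c) ↔ d m % N = c := by
      have e : d m + (N - c) + c = d m + N := by omega
      rw [← Nat.modEq_zero_iff_dvd]
      constructor
      · intro h0
        have h1 := h0.add_right c
        rw [e, zero_add] at h1
        simpa [Nat.ModEq, Nat.mod_eq_of_lt hc] using h1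
      · intro h0
        refine Nat.ModEq.add_right_cancel' c ?_
        rw [e, zero_add]
        simpa [Nat.ModEq, Nat.mod_eq_of_lt hc] using h0
    rw [Fin.sum_univ_eq_sum_range fun k => ζ ^ (k * (d m + (N - c)))]
    simp_rw [mul_comm _ (d m + (N - c)), pow_mul]
    split_ifs with hm
    · rw [(hζ.pow_eq_one_iff_dvd _).2 (hdvd.2 hm)]
      simp
    · have hne : ζ ^ (d m + (N - c)) ≠ 1 := fun h1 =>
        hm (hdvd.1 ((hζ.pow_eq_one_iff_dvd _).1 h1))
      rw [geom_sum_eq hne, ← pow_mul, mul_comm, pow_mul, hζ.pow_eq_one, one_pow, sub_self,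
        zero_div]
  have key : (N : ℂ) * ∑ m ∈ S with d m % N = c, w m = 0 := by
    calc (N : ℂ) * ∑ m ∈ S with d m % N = c, w m
        = ∑ m ∈ S, w m * ∑ k : Fin N, ζ ^ ((k : ℕ) * (d m + (N - c))) := by
          rw [Finset.sum_filter, Finset.mul_sum]
          refine Finset.sum_congr rfl fun m _ => ?_
          rw [orth]
          split_ifs <;> ring
      _ = ∑ k : Fin N, ζ ^ ((k : ℕ) * (N - c)) * ∑ m ∈ S, w m * ζ ^ ((k : ℕ) * d m) := by
          simp_rw [Finset.mul_sum]
          rw [Finset.sum_comm]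
          refine Finset.sum_congr rfl fun k _ => Finset.sum_congr rfl fun m _ => ?_
          rw [mul_add, pow_add]
          ring
      _ = 0 := by simp [h]
  exact (mul_eq_zero.1 key).resolve_left hN

/-! ### Lifting injectivity from characteristic `p` -/

lemma Matrix.eq_zero_of_mulVec_eq_zero_of_zmod {m n : Type*} [Fintype m] [Fintype n]
    (p : ℕ) [Fact p.Prime] (A : Matrix m n ℤ)
    (h : ∀ v : n → ZMod p, (A.map fun x => (x : ZMod p)).mulVec v = 0 → v = 0)
    {v : n → ℂ} (hv : (A.map fun x => (x : ℂ)).mulVec v = 0) : v = 0 := by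
  classical
  obtain ⟨g, hg⟩ := LinearMap.exists_leftInverse_of_injective
    (Matrix.toLin' (A.map fun x => (x : ZMod p)))
    (LinearMap.ker_eq_bot'.2 fun v hv => h v (by simpa using hv))
  let B : Matrix n m ℤ := (LinearMap.toMatrix' g).map fun x => (x.val : ℤ)
  have hB : B.map (Int.castRingHom (ZMod p)) = LinearMap.toMatrix' g := by
    ext i j
    simp [B]
  have hBA : (B * A).map (Int.castRingHom (ZMod p)) = 1 := by
    rw [Matrix.map_mul, hB, ← LinearMap.toMatrix'_id, ← hg, LinearMap.toMatrix'_comp,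
      LinearMap.toMatrix'_toLin']
    rfl
  have hdet : (B * A).det ≠ 0 := by
    intro h0
    have h1 := (Int.castRingHom (ZMod p)).map_det (B * A)
    rw [RingHom.mapMatrix_apply, hBA, h0] at h1
    simp at h1
  refine Matrix.eq_zero_of_mulVec_eq_zero (M := (B * A).map (Int.castRingHom ℂ)) ?_ ?_
  · have h1 := (Int.castRingHom ℂ).map_det (B * A)
    rw [RingHom.mapMatrix_apply] at h1
    rw [← h1]
    simpa using hdet
  · rw [Matrix.map_mul, ← Matrix.mulVec_mulVec]
    change Matrix.mulVec _ ((A.map fun x => (x : ℂ)).mulVec v) = 0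
    rw [hv, Matrix.mulVec_zero]

/-! ### Gaussian elimination modulo 31 -/

instance fact_prime_thirty_one : Fact (Nat.Prime 31) := ⟨by norm_num⟩

/-- The row `a • t + b • s` modulo 31, written with recursors and `Nat` primitives so that the
kernel evaluates it quickly. -/
def combineRows (a b : ℕ) (s : List ℕ) : List ℕ → List ℕ :=
  s.rec (fun _ => []) fun x _ ih t =>
    t.rec [] fun y ys _ => Nat.mod (Nat.add (Nat.mul a y) (Nat.mul b x)) 31 :: ih ys

/-- Clear the first entry of `row` using `pivot`, and delete that entry. -/
def eliminateRow (pivot row : List ℕ) : List ℕ :=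
  combineRows (pivot.headD 0) (Nat.sub 31 (row.headD 0)) pivot.tail row.tail

/-- Whether division-free elimination modulo 31 finds a pivot in each of the first `n` columns. -/
def eliminates : ℕ → List (List ℕ) → Bool
  | 0, _ => true
  | n + 1, rows =>
    match rows.find? (fun r => r.headD 0 != 0) with
    | none => false
    | some pivot =>
      eliminates n ((rows.eraseP (fun r => r.headD 0 != 0)).map (eliminateRow pivot))

/-- The value modulo 31 of the linear form with coefficients `r` at `v`. -/
def rowEval (r : List ℕ) (v : List (ZMod 31)) : ZMod 31 :=
  (List.zipWith (fun (a : ℕ) x => (a : ZMod 31) * x) r v).sum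

lemma combineRows_cons (a b x y : ℕ) (s t : List ℕ) :
    combineRows a b (x :: s) (y :: t) = (a * y + b * x) % 31 :: combineRows a b s t := rfl

lemma length_combineRows (a b : ℕ) {s t : List ℕ} (h : s.length = t.length) :
    (combineRows a b s t).length = s.length := by
  induction s generalizing t with
  | nil => rfl
  | cons x s ih =>
    obtain _ | ⟨y, t⟩ := t
    · simp at h
    · rw [combineRows_cons, List.length_cons, List.length_cons, ih (by simpa using h)]

lemma rowEval_combineRows (a b : ℕ) {s t : List ℕ} {v : List (ZMod 31)}
    (hs : s.length = v.length) (ht : t.length = v.length) :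
    rowEval (combineRows a b s t) v = a * rowEval t v + b * rowEval s v := by
  induction v generalizing s t with
  | nil => simp [rowEval]
  | cons z v ih =>
    obtain _ | ⟨x, s⟩ := s
    · simp at hs
    obtain _ | ⟨y, t⟩ := t
    · simp at ht
    have h := ih (s := s) (t := t) (by simpa using hs) (by simpa using ht)
    simp only [rowEval] at h ⊢
    rw [combineRows_cons]
    simp only [List.zipWith_cons_cons, List.sum_cons, h, ZMod.natCast_mod]
    push_cast
    ring

lemma lt_of_mem_combineRows {a b k : ℕ} {s t : List ℕ} (h : k ∈ combineRows a b s t) :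
    k < 31 := by
  induction s generalizing t with
  | nil => simp [combineRows] at h
  | cons x s ih =>
    obtain _ | ⟨y, t⟩ := t
    · simp [combineRows] at h
    · rw [combineRows_cons, List.mem_cons] at h
      obtain rfl | h := h
      · exact Nat.mod_lt _ (by norm_num)
      · exact ih h

lemma eq_zero_of_eliminates {rows : List (List ℕ)} {v : List (ZMod 31)}
    (h : eliminates v.length rows = true)
    (hlen : ∀ r ∈ rows, r.length = v.length) (hlt : ∀ r ∈ rows, ∀ k ∈ r, k < 31)
    (heval : ∀ r ∈ rows, rowEval r v = 0) : ∀ x ∈ v, x = 0 := by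
  induction v generalizing rows with
  | nil => simp
  | cons z v ih =>
    rw [List.length_cons, eliminates] at h
    split at h
    · simp at h
    rename_i pivot hpivot
    have hpmem := List.mem_of_find?_eq_some hpivot
    have hpne := List.find?_some hpivot
    obtain _ | ⟨b, s⟩ := pivot
    · simp at hpne
    have hb : (b : ZMod 31) ≠ 0 := by
      have hb31 := hlt _ hpmem b (by simp)
      have hb0 : b ≠ 0 := by simpa using hpne
      rw [Ne, ZMod.natCast_eq_zero_iff]
      exact Nat.not_dvd_of_pos_of_lt (Nat.pos_of_ne_zero hb0) hb31
    have hsv : s.length = v.length := by simpa using hlen _ hpmem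
    have hs : b * z + rowEval s v = 0 := by simpa [rowEval] using heval _ hpmem
    have hv : ∀ x ∈ v, x = 0 := by
      refine ih h ?_ ?_ ?_ <;> intro r hr <;> obtain ⟨u, hu, rfl⟩ := List.mem_map.1 hr <;>
        replace hu := List.mem_of_mem_eraseP hu <;>
        obtain _ | ⟨a, t⟩ := u
      · simpa using hlen _ hu
      · have htv : t.length = v.length := by simpa using hlen _ hu
        exact (length_combineRows _ _ (hsv.trans htv.symm)).trans hsv
      · simpa using hlen _ hu
      · exact fun k hk => lt_of_mem_combineRows hk
      · simpa using hlen _ hu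
      · have htv : t.length = v.length := by simpa using hlen _ hu
        have ht : a * z + rowEval t v = 0 := by simpa [rowEval] using heval _ hu
        have ha : ((31 - a : ℕ) : ZMod 31) = -a := by
          rw [Nat.cast_sub (hlt _ hu a (by simp)).le, ZMod.natCast_self, zero_sub]
        refine (rowEval_combineRows _ _ hsv htv).trans ?_
        change (b : ZMod 31) * rowEval t v + ((31 - a : ℕ) : ZMod 31) * rowEval s v = 0
        rw [ha]
        linear_combination (b : ZMod 31) * ht - (a : ZMod 31) * hs
    have hzero : rowEval s v = 0 := by
      rw [rowEval]
      refine List.sum_eq_zero fun y hy => ?_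
      obtain ⟨i, hi, rfl⟩ := List.mem_iff_getElem.1 hy
      rw [List.getElem_zipWith, hv _ (List.getElem_mem _), mul_zero]
    rw [hzero, add_zero] at hs
    rintro x (_ | ⟨_, hx⟩)
    · exact (mul_eq_zero.1 hs).resolve_left hb
    · exact hv x hx

/-! ### The monomials of degree between 5 and 27 in a residue class -/

/-- The exponents `(i, j)` with `5 ≤ i + j ≤ 27` and `i + 3 j` in the class `c` modulo 7. -/
def classExponents (c : ℕ) : List (ℕ × ℕ) :=
  (List.range 28 ×ˢ List.range 28).filter fun e =>
    5 ≤ e.1 + e.2 ∧ e.1 + e.2 ≤ 27 ∧ (e.1 + 3 * e.2) % 7 = c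

/-- The triples `(s, a, b)` with `s ∈ {1, 2}` and `a + b ≤ 6`, indexing conditions at `(s, 1)`. -/
def orderConditions : List (ℕ × ℕ × ℕ) :=
  ([1, 2] ×ˢ (List.range 7 ×ˢ List.range 7)).filter fun k => k.2.1 + k.2.2 ≤ 6

/-- The eigenvalue of the monomial with exponent `e` under the condition `k`. -/
def conditionEntry (k : ℕ × ℕ × ℕ) (e : ℕ × ℕ) : ℕ :=
  k.1 ^ e.1 * (e.1 ^ k.2.1 * e.2 ^ k.2.2)

/-- The rows of the system of conditions on the class `c`, reduced modulo 31. -/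
def conditionRows (c : ℕ) : List (List ℕ) :=
  orderConditions.map fun k => (classExponents c).map fun e => conditionEntry k e % 31

lemma eliminates_conditionRows :
    ∀ c < 7, eliminates (classExponents c).length (conditionRows c) = true := by
  decide +kernel

lemma nodup_classExponents (c : ℕ) : (classExponents c).Nodup :=
  (List.nodup_range.product List.nodup_range).filter _

lemma eq_zero_of_conditions {c : ℕ} (hc : c < 7) {g : ℕ × ℕ → ℂ}
    (hg : ∀ k ∈ orderConditions,
      ∑ e ∈ (classExponents c).toFinset, g e * conditionEntry k e = 0) :
    ∀ e ∈ classExponents c, g e = 0 := by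
  let A : Matrix {k // k ∈ orderConditions.toFinset} {e // e ∈ (classExponents c).toFinset} ℤ :=
    Matrix.of fun k e => (conditionEntry k e : ℤ)
  have hA := Matrix.eq_zero_of_mulVec_eq_zero_of_zmod 31 A (fun v hv => ?_)
    (v := fun e => g e) ?_
  · intro e he
    exact congrFun hA ⟨e, List.mem_toFinset.2 he⟩
  · classical
    let w : ℕ × ℕ → ZMod 31 := fun e => if h : e ∈ (classExponents c).toFinset then v ⟨e, h⟩ else 0
    have hw : ∀ x ∈ (classExponents c).map w, x = 0 := by
      refine eq_zero_of_eliminates (rows := conditionRows c)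
        (by rw [List.length_map]; exact eliminates_conditionRows c hc) ?_ ?_ ?_
      · intro r hr
        obtain ⟨k, -, rfl⟩ := List.mem_map.1 hr
        simp
      · intro r hr a ha
        obtain ⟨k, -, rfl⟩ := List.mem_map.1 hr
        obtain ⟨e, -, rfl⟩ := List.mem_map.1 ha
        exact Nat.mod_lt _ (by norm_num)
      · intro r hr
        obtain ⟨k, hk, rfl⟩ := List.mem_map.1 hr
        have h := congrFun hv ⟨k, List.mem_toFinset.2 hk⟩
        rw [rowEval, List.zipWith_map, List.zipWith_self,
          ← List.sum_toFinset _ (nodup_classExponents c), ← Finset.sum_coe_sort]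
        refine (Finset.sum_congr rfl fun e _ => ?_).trans h
        simp only [w, dif_pos e.2, ZMod.natCast_mod, Matrix.map_apply, A, Matrix.of_apply,
          Int.cast_natCast]
    funext e
    have h := hw _ (List.mem_map_of_mem (List.mem_toFinset.1 e.2))
    rwa [show w e = v e from dif_pos e.2] at h
  · funext k
    have h := hg k (List.mem_toFinset.1 k.2)
    rw [← Finset.sum_coe_sort] at h
    refine (Finset.sum_congr rfl fun e _ => ?_).trans h
    simp only [Matrix.map_apply, A, Matrix.of_apply, Int.cast_natCast, mul_comm]

theorem L27_5_7p14_empty :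
    ∃ (p : ℂ × ℂ) (q : Fin 14 → ℂ × ℂ),
      ∀ f : MvPolynomial (Fin 2) ℂ, f.totalDegree ≤ 27 →
        f ∈ ptIdeal p ^ 5 → (∀ i, f ∈ ptIdeal (q i) ^ 7) → f = 0 := by
  have hζ := Complex.isPrimitiveRoot_exp 7 (by norm_num)
  set ζ := Complex.exp (2 * Real.pi * Complex.I / (7 : ℕ))
  let e := finProdFinEquiv (m := 2) (n := 7)
  refine ⟨(0, 0), fun i => ((((e.symm i).1 : ℕ) + 1 : ℂ) * ζ ^ ((e.symm i).2 : ℕ),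
    ζ ^ (3 * ((e.symm i).2 : ℕ))), fun f hdeg hp hq => ?_⟩
  let mon : ℕ × ℕ → Fin 2 →₀ ℕ := fun e => Finsupp.equivFunOnFinite.symm ![e.1, e.2]
  have hmon (m : Fin 2 →₀ ℕ) : mon (m 0, m 1) = m := by
    ext i
    fin_cases i <;> rfl
  have hinj : Function.Injective mon := fun a b hab =>
    Prod.ext (DFunLike.congr_fun hab 0) (DFunLike.congr_fun hab 1)
  have hmem {m : Fin 2 →₀ ℕ} (hm : m ∈ f.support) :
      (m 0, m 1) ∈ classExponents ((m 0 + 3 * m 1) % 7) := by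
    have h5 := le_of_mem_ptIdeal_zero_pow hp hm
    have h27 := (le_totalDegree hm).trans hdeg
    rw [Finsupp.sum_fintype _ _ (fun _ => rfl), Fin.sum_univ_two] at h27
    simp [classExponents]
    omega
  have hzero : ∀ c < 7, ∀ e ∈ classExponents c, coeff (mon e) f = 0 := by
    intro c hc
    refine eq_zero_of_conditions hc fun k hk => ?_
    obtain ⟨s, a, b⟩ := k
    obtain ⟨σ, rfl, hab⟩ : ∃ σ : Fin 2, s = σ + 1 ∧ a + b < 7 := by
      have h : (s = 1 ∨ s = 2) ∧ a + b < 7 := by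
        simp [orderConditions] at hk
        omega
      obtain ⟨rfl | rfl, hab⟩ := h
      · exact ⟨0, rfl, hab⟩
      · exact ⟨1, rfl, hab⟩
    have hsep := hζ.sum_filter_mod_eq_zero f.support
      (fun m => coeff m f * conditionEntry ((σ : ℕ) + 1, a, b) (m 0, m 1))
      (fun m => m 0 + 3 * m 1) (fun κ => ?_) hc
    · rw [← hsep]
      refine (Finset.sum_image (f := fun m => coeff m f *
        (conditionEntry ((σ : ℕ) + 1, a, b) (m 0, m 1) : ℂ)) hinj.injOn).symm.trans
        (Eq.symm ?_)
      refine Finset.sum_subset (fun m hm => ?_) fun m hm hm' => ?_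
      · rw [Finset.mem_filter] at hm
        have h := hmem hm.1
        rw [hm.2] at h
        exact Finset.mem_image.2 ⟨_, List.mem_toFinset.2 h, hmon m⟩
      · obtain ⟨e, he, rfl⟩ := Finset.mem_image.1 hm
        have hcls : (mon e 0 + 3 * mon e 1) % 7 = c := by
          have h := List.mem_toFinset.1 he
          simp [classExponents] at h
          exact h.2.2.2
        rw [Finset.mem_filter, not_and'] at hm'
        rw [notMem_support_iff.1 (hm' hcls), zero_mul]
    · have h := sum_coeff_eq_zero_of_mem_ptIdeal_pow (hq (e (σ, κ))) hab
      rw [← h]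
      refine Finset.sum_congr rfl fun m _ => ?_
      simp only [Equiv.symm_apply_apply, conditionEntry]
      push_cast
      rw [mul_pow]
      ring
  ext m
  rw [coeff_zero]
  by_contra hm
  have h := hzero _ (Nat.mod_lt _ (by norm_num)) _ (hmem (mem_support_iff.2 hm))
  rw [hmon] at h
  exact hm h
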